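/- Let E be a real inner product space, f : E → ℝ differentiable with L-Lipschitz gradient (L > 0) and bounded below by f*, set M = f(x_0) − f*, and let ε > 0. Let x_0, x_1, …, x_T be generated by x_{k+1} = x_k − v_k/(2L) where each v_k ∈ E satisfies ‖v_k − ∇f(x_k)‖² ≤ ε². If T ≥ 4ML/ε² and T ≥ 1, then (1/T)·Σ_{k=0}^{T−1} ‖∇f(x_k)‖² ≤ 10ε²; in particular there exists an index k < T with ‖∇f(x_k)‖² ≤ 10ε². -/

import Mathlib

/-- The descent lemma: a function with `L`-Lipschitz gradient lies below its quadratic upper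
model. -/
theorem le_quadratic_of_lipschitz_gradient
    {E : Type*} [NormedAddCommGroup E] [InnerProductSpace ℝ E]
    {f : E → ℝ} {f' : E → E} {L : ℝ}
    (hdiff : ∀ x, HasFDerivAt f (innerSL ℝ (f' x)) x)
    (hlip : ∀ x y, ‖f' x - f' y‖ ≤ L * ‖x - y‖) (x d : E) :
    f (x + d) ≤ f x + inner ℝ (f' x) d + L / 2 * ‖d‖ ^ 2 := by
  let φ : ℝ → ℝ := fun t ↦ f (x + t • d) - t * inner ℝ (f' x) d - L / 2 * ‖d‖ ^ 2 * t ^ 2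
  have hφ (t : ℝ) : HasDerivAt φ
      (inner ℝ (f' (x + t • d)) d - inner ℝ (f' x) d - L * ‖d‖ ^ 2 * t) t := by
    have hline : HasDerivAt (fun t : ℝ ↦ x + t • d) d t := by
      simpa using ((hasDerivAt_id t).smul_const d).const_add x
    have hf := (hdiff (x + t • d)).comp_hasDerivAt t hline
    refine ((hf.sub ((hasDerivAt_id t).mul_const (inner ℝ (f' x) d))).sub
      ((hasDerivAt_pow 2 t).const_mul (L / 2 * ‖d‖ ^ 2))).congr_deriv ?_
    simp only [innerSL_apply_apply]
    push_cast
    ring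
  have hanti : AntitoneOn φ (Set.Icc 0 1) := by
    refine antitoneOn_of_hasDerivWithinAt_nonpos (convex_Icc 0 1)
      (fun t _ ↦ (hφ t).continuousAt.continuousWithinAt)
      (fun t _ ↦ (hφ t).hasDerivWithinAt) fun t ht ↦ ?_
    rw [interior_Icc] at ht
    have hnorm : ‖f' (x + t • d) - f' x‖ ≤ L * (t * ‖d‖) := by
      simpa [norm_smul, abs_of_pos ht.1] using hlip (x + t • d) x
    have hinner := real_inner_le_norm (f' (x + t • d) - f' x) d
    rw [inner_sub_left] at hinner
    nlinarith [mul_le_mul_of_nonneg_right hnorm (norm_nonneg d)]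
  have h := hanti (Set.left_mem_Icc.2 zero_le_one) (Set.right_mem_Icc.2 zero_le_one) zero_le_one
  simp only [φ, one_smul, zero_smul, add_zero] at h
  linarith

/-- One step of inexact gradient descent with step size `1 / (2 * L)` along an estimate `v` of the
gradient. -/
theorem norm_gradient_sq_le_of_inexact_step
    {E : Type*} [NormedAddCommGroup E] [InnerProductSpace ℝ E]
    {f : E → ℝ} {f' : E → E} {L : ℝ} (hL : 0 < L)
    (hdiff : ∀ x, HasFDerivAt f (innerSL ℝ (f' x)) x)
    (hlip : ∀ x y, ‖f' x - f' y‖ ≤ L * ‖x - y‖) (x v : E) :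
    ‖f' x‖ ^ 2 ≤ 4 * L * (f x - f (x - (1 / (2 * L)) • v)) + ‖v - f' x‖ ^ 2 := by
  have h := le_quadratic_of_lipschitz_gradient hdiff hlip x (-((1 / (2 * L)) • v))
  rw [← sub_eq_add_neg, inner_neg_right, norm_neg, real_inner_smul_right, norm_smul, mul_pow,
    Real.norm_eq_abs, sq_abs] at h
  have hscaled : 4 * L * (f (x - (1 / (2 * L)) • v) - f x)
      ≤ -2 * inner ℝ (f' x) v + ‖v‖ ^ 2 / 2 := by
    calc _ ≤ 4 * L * (-(1 / (2 * L) * inner ℝ (f' x) v)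
            + L / 2 * ((1 / (2 * L)) ^ 2 * ‖v‖ ^ 2)) := by
          gcongr
          linarith
      _ = _ := by
          field_simp
          ring
  have hsub := norm_sub_sq_real v (f' x)
  rw [real_inner_comm] at hsub
  nlinarith [sq_nonneg ‖v‖]

/-- Let `E` be a real inner product space, `f : E → ℝ`
differentiable with `L`-Lipschitz gradient `f'` (`L > 0`) and bounded below by
`f*`, set `M = f(x_0) − f*`, and let `ε > 0`. Let `x_0, …, x_T` be generated
by `x_{k+1} = x_k − v_k/(2L)` where each `v_k` satisfies
`‖v_k − ∇f(x_k)‖² ≤ ε²`. If `T ≥ 4ML/ε²` and `T ≥ 1`, then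
`(1/T) Σ_{k<T} ‖∇f(x_k)‖² ≤ 10ε²`; in particular there exists `k < T` with
`‖∇f(x_k)‖² ≤ 10ε²`. -/
theorem stmt_11
    {E : Type*} [NormedAddCommGroup E] [InnerProductSpace ℝ E]
    (f : E → ℝ) (f' : E → E) (L fstar ε : ℝ) (hL : 0 < L) (hε : 0 < ε)
    (hdiff : ∀ x, HasFDerivAt f (innerSL ℝ (f' x)) x)
    (hlip : ∀ x y, ‖f' x - f' y‖ ≤ L * ‖x - y‖)
    (hbdd : ∀ x, fstar ≤ f x)
    (T : ℕ) (hT1 : 1 ≤ T) (x v : ℕ → E)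
    (hupd : ∀ k < T, x (k + 1) = x k - (1 / (2 * L)) • v k)
    (herr : ∀ k < T, ‖v k - f' (x k)‖ ^ 2 ≤ ε ^ 2)
    (M : ℝ) (hM : M = f (x 0) - fstar)
    (hT : 4 * M * L / ε ^ 2 ≤ (T : ℝ)) :
    (1 / (T : ℝ)) * ∑ k ∈ Finset.range T, ‖f' (x k)‖ ^ 2 ≤ 10 * ε ^ 2
      ∧ ∃ k < T, ‖f' (x k)‖ ^ 2 ≤ 10 * ε ^ 2 := by
  have hT0 : (0 : ℝ) < T := by exact_mod_cast hT1
  have hstep : ∀ k ∈ Finset.range T,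
      ‖f' (x k)‖ ^ 2 ≤ 4 * L * (f (x k) - f (x (k + 1))) + ε ^ 2 := fun k hk ↦ by
    have hk := Finset.mem_range.1 hk
    rw [hupd k hk]
    linarith [norm_gradient_sq_le_of_inexact_step hL hdiff hlip (x k) (v k), herr k hk]
  have hsum : ∑ k ∈ Finset.range T, ‖f' (x k)‖ ^ 2 ≤ T * (10 * ε ^ 2) := by
    have h := Finset.sum_le_sum hstep
    rw [Finset.sum_add_distrib, ← Finset.mul_sum, Finset.sum_range_sub', Finset.sum_const,
      Finset.card_range, nsmul_eq_mul] at h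
    rw [div_le_iff₀ (by positivity)] at hT
    have hdecrease : L * (f (x 0) - f (x T)) ≤ L * M := by
      gcongr
      linarith [hbdd (x T)]
    nlinarith [mul_pos hT0 (pow_pos hε 2)]
  constructor
  · rw [one_div, inv_mul_le_iff₀ hT0]
    exact hsum
  · obtain ⟨k, hk, hle⟩ := Finset.exists_le_of_sum_le
      (s := Finset.range T) (f := fun k ↦ ‖f' (x k)‖ ^ 2) (g := fun _ ↦ 10 * ε ^ 2)
      (Finset.nonempty_range_iff.2 (by omega)) (by simpa using hsum)
    exact ⟨k, Finset.mem_range.1 hk, hle⟩
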